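/- Fix an integer c ≥ 3. For every n with 1 ≤ n ≤ 12c: if n = 8c + a for some odd integer a with 5 ≤ a ≤ 2c − 3, then N(n, 2, {1, 2c}) = N(φ₁(n), 2, {1, 6}) ∪ {1}; otherwise N(n, 2, {1, 2c}) = N(φ₁(n), 2, {1, 6}). -/

import Mathlib

/-- The minimum excludant of a set of naturals. -/
noncomputable def mex (S : Set ℕ) : ℕ := sInf {v | v ∉ S}

/-- Fueled auxiliary for the Grundy sequence of CUT with cut-set `C`. -/
noncomputable def cutGAux (C : Finset ℕ) : ℕ → ℕ → ℕ
  | 0, _ => 0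
  | fuel + 1, n =>
      mex {v | ∃ d ∈ C, ∃ l : List ℕ, l.length = d + 1 ∧ (∀ x ∈ l, 0 < x) ∧
            l.sum = n ∧ (l.map (cutGAux C fuel)).foldr (· ^^^ ·) 0 = v}

/-- The Grundy (nim-value) sequence of the game CUT with cut-set `C`. -/
noncomputable def cutG (C : Finset ℕ) (n : ℕ) : ℕ := cutGAux C n n

/-- The nim-value of an option (a tuple of pile sizes). -/
noncomputable def nimVal (C : Finset ℕ) (l : List ℕ) : ℕ :=
  (l.map (cutG C)).foldr (· ^^^ ·) 0

/-- The nim-set `N(n, p, C)`. -/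
def nimSet (n p : ℕ) (C : Finset ℕ) : Set ℕ :=
  {v | ∃ l : List ℕ, l.length = p ∧ (∀ x ∈ l, 0 < x) ∧ l.sum = n ∧ nimVal C l = v}

/-- The map `r ↦ r'` on `1 ≤ r ≤ 2c`. -/
def rPrime (c r : ℕ) : ℕ :=
  if r = 1 then 1
  else if r = 2 then 2
  else if r = 2*c - 1 then 5
  else if r = 2*c then 6
  else if r % 2 = 1 then 3
  else 4

/-- The correspondence `φ_p`: writing `n = 2cq + r + p − 1` with `1 ≤ r ≤ 2c`,
`φ_p(n) = 6q + r' + p − 1`. -/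
def phi (c p n : ℕ) : ℕ :=
  6 * ((n - p) / (2*c)) + rPrime c ((n - p) % (2*c) + 1) + p - 1

theorem mex_eq {S : Set ℕ} {v : ℕ} (hv : v ∉ S) (h : ∀ u < v, u ∈ S) : mex S = v := by
  refine le_antisymm (Nat.sInf_le hv) ?_
  by_contra! hlt
  exact Nat.sInf_mem (s := {v | v ∉ S}) ⟨v, hv⟩ (h _ hlt)

theorem List.length_le_sum_of_forall_pos (l : List ℕ) (h : ∀ x ∈ l, 0 < x) :
    l.length ≤ l.sum := by
  induction l with
  | nil => simp
  | cons a l ih =>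
    have h1 := ih fun x hx => h x (by simp [hx])
    have h2 := h a (by simp)
    simp only [List.length_cons, List.sum_cons]
    omega

theorem List.lt_sum_of_mem_of_forall_pos {l : List ℕ} (h : ∀ x ∈ l, 0 < x)
    (hl : 2 ≤ l.length) {x : ℕ} (hx : x ∈ l) : x < l.sum := by
  have h1 := (List.perm_cons_erase hx).sum_eq
  have h2 := List.length_le_sum_of_forall_pos (l.erase x)
    fun y hy => h y (List.mem_of_mem_erase hy)
  have h3 := List.length_erase_of_mem hx
  simp only [List.sum_cons] at h1
  omega

theorem cutGAux_eq_of_le {C : Finset ℕ} (hC : 0 ∉ C) (n : ℕ) :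
    ∀ f f', 0 < n → n ≤ f → n ≤ f' → cutGAux C f n = cutGAux C f' n := by
  induction n using Nat.strong_induction_on with
  | _ n ih =>
    intro f f' hn hf hf'
    obtain ⟨f, rfl⟩ : ∃ k, f = k + 1 := ⟨f - 1, by omega⟩
    obtain ⟨f', rfl⟩ : ∃ k, f' = k + 1 := ⟨f' - 1, by omega⟩
    have key : ∀ d ∈ C, ∀ l : List ℕ, l.length = d + 1 → (∀ x ∈ l, 0 < x) → l.sum = n →
        l.map (cutGAux C f) = l.map (cutGAux C f') := by
      intro d hd l hl hpos hsum
      refine List.map_congr_left fun x hx => ?_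
      have hd0 : d ≠ 0 := fun h => hC (h ▸ hd)
      have := List.lt_sum_of_mem_of_forall_pos hpos (by omega) hx
      exact ih x (by omega) f f' (hpos x hx) (by omega) (by omega)
    simp only [cutGAux]
    congr 1
    ext v
    constructor
    · rintro ⟨d, hd, l, h1, h2, h3, h4⟩
      exact ⟨d, hd, l, h1, h2, h3, by rw [← key d hd l h1 h2 h3]; exact h4⟩
    · rintro ⟨d, hd, l, h1, h2, h3, h4⟩
      exact ⟨d, hd, l, h1, h2, h3, by rw [key d hd l h1 h2 h3]; exact h4⟩

theorem cutG_eq_mex {C : Finset ℕ} (hC : 0 ∉ C) {n : ℕ} (hn : 0 < n) :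
    cutG C n = mex {v | ∃ d ∈ C, v ∈ nimSet n (d + 1) C} := by
  obtain ⟨f, rfl⟩ : ∃ k, n = k + 1 := ⟨n - 1, by omega⟩
  have key : ∀ d ∈ C, ∀ l : List ℕ, l.length = d + 1 → (∀ x ∈ l, 0 < x) → l.sum = f + 1 →
      l.map (cutGAux C f) = l.map (cutG C) := by
    intro d hd l hl hpos hsum
    refine List.map_congr_left fun x hx => ?_
    have hd0 : d ≠ 0 := fun h => hC (h ▸ hd)
    have := List.lt_sum_of_mem_of_forall_pos hpos (by omega) hx
    exact cutGAux_eq_of_le hC x f x (hpos x hx) (by omega) le_rfl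
  rw [cutG, cutGAux]
  congr 1
  ext v
  constructor
  · rintro ⟨d, hd, l, h1, h2, h3, h4⟩
    exact ⟨d, hd, l, h1, h2, h3, by rw [nimVal, ← key d hd l h1 h2 h3]; exact h4⟩
  · rintro ⟨d, hd, l, h1, h2, h3, h4⟩
    exact ⟨d, hd, l, h1, h2, h3, by rw [key d hd l h1 h2 h3]; exact h4⟩

/-- The nim-value of a pile of size `x + 1`, corrected by the parity of `x`. -/
def blockVal (c x : ℕ) : ℕ :=
  if x < 2 * c then 0 else if x < 4 * c then 2 else if x = 4 * c then 1
  else if x < 6 * c then 5 else if x < 8 * c then 3 else if x < 10 * c then 4 else 6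

/-- The closed form of the Grundy sequence of `{1, 2c}` on `1 ≤ n ≤ 12c`. -/
def closedG (c n : ℕ) : ℕ := blockVal c (n - 1) ^^^ ((n - 1) % 2)

/-- The least excess (total size minus number of piles) needed for a position to have
parity-corrected nim-value `w`. -/
def minExcess (c w : ℕ) : ℕ :=
  if w = 0 then 0 else if w = 1 then 4 * c else if w = 2 then 2 * c else if w = 3 then 6 * c
  else if w = 4 then 8 * c else if w = 5 then 4 * c + 1 else if w = 6 then 10 * c
  else 6 * c + 1

/-- The parity-corrected nim-values `w` attained by two piles of total excess `e`. -/
def PairVal (c e w : ℕ) : Prop :=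
  (w = 0 ∧ (e + 2 ≤ 4 * c ∨ (4 * c ≤ e ∧ e + 2 ≤ 8 * c) ∨ e = 8 * c ∨ 8 * c + 2 ≤ e)) ∨
  (w = 1 ∧ ((4 * c ≤ e ∧ e + 1 ≤ 6 * c) ∨ 8 * c ≤ e)) ∨
  (w = 2 ∧ ((2 * c ≤ e ∧ e + 2 ≤ 6 * c) ∨ 10 * c ≤ e)) ∨
  (w = 3 ∧ 6 * c ≤ e ∧ e + 2 ≤ 10 * c) ∨
  (w = 4 ∧ 8 * c ≤ e) ∨
  (w = 5 ∧ 4 * c + 1 ≤ e ∧ e + 2 ≤ 8 * c) ∨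
  (w = 6 ∧ 10 * c ≤ e) ∨
  (w = 7 ∧ 6 * c + 1 ≤ e ∧ e + 2 ≤ 10 * c)

theorem blockVal_cases (c x : ℕ) :
    (x < 2 * c ∧ blockVal c x = 0) ∨ (2 * c ≤ x ∧ x < 4 * c ∧ blockVal c x = 2) ∨
    (4 * c ≤ x ∧ x ≤ 4 * c ∧ blockVal c x = 1) ∨
    (4 * c < x ∧ x < 6 * c ∧ blockVal c x = 5) ∨
    (6 * c ≤ x ∧ x < 8 * c ∧ blockVal c x = 3) ∨
    (8 * c ≤ x ∧ x < 10 * c ∧ blockVal c x = 4) ∨ (10 * c ≤ x ∧ blockVal c x = 6) := by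
  unfold blockVal
  split_ifs <;> omega

theorem pairVal_of_add {c x y : ℕ} (h : x + y + 2 ≤ 12 * c) :
    PairVal c (x + y) (blockVal c x ^^^ blockVal c y) := by
  wlog hxy : x ≤ y generalizing x y
  · rw [add_comm, Nat.xor_comm]
    exact this (by omega) (by omega)
  rcases blockVal_cases c x with hx | hx | hx | hx | hx | hx | hx <;>
  rcases blockVal_cases c y with hy | hy | hy | hy | hy | hy | hy <;>
  first
  | (exfalso; omega)
  | (simp [hx, hy, PairVal]; omega)

theorem exists_add_of_pairVal {c e w : ℕ} (hc : 3 ≤ c) (he : e + 2 ≤ 12 * c)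
    (h : PairVal c e w) : ∃ x y, x + y = e ∧ blockVal c x ^^^ blockVal c y = w := by
  suffices H : ∃ x ≤ e, blockVal c x ^^^ blockVal c (e - x) = w by
    obtain ⟨x, hx, h⟩ := H
    exact ⟨x, e - x, by omega, h⟩
  have use : ∀ x a b, x ≤ e → blockVal c x = a → blockVal c (e - x) = b → a ^^^ b = w →
      ∃ x ≤ e, blockVal c x ^^^ blockVal c (e - x) = w := by
    rintro x a b hx rfl rfl h
    exact ⟨x, hx, h⟩
  have h0 : ∀ x, x < 2 * c → blockVal c x = 0 := by
    intro x; have := blockVal_cases c x; omega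
  have h2 : ∀ x, 2 * c ≤ x → x < 4 * c → blockVal c x = 2 := by
    intro x; have := blockVal_cases c x; omega
  have h1 : ∀ x, x = 4 * c → blockVal c x = 1 := by
    intro x; have := blockVal_cases c x; omega
  have h5 : ∀ x, 4 * c < x → x < 6 * c → blockVal c x = 5 := by
    intro x; have := blockVal_cases c x; omega
  have h3 : ∀ x, 6 * c ≤ x → x < 8 * c → blockVal c x = 3 := by
    intro x; have := blockVal_cases c x; omega
  have h4 : ∀ x, 8 * c ≤ x → x < 10 * c → blockVal c x = 4 := by
    intro x; have := blockVal_cases c x; omega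
  have h6 : ∀ x, 10 * c ≤ x → blockVal c x = 6 := by
    intro x; have := blockVal_cases c x; omega
  rcases h with ⟨rfl, h | h | h | h⟩ | ⟨rfl, h | h⟩ | ⟨rfl, h | h⟩ | ⟨rfl, h⟩ | ⟨rfl, h⟩ |
    ⟨rfl, h⟩ | ⟨rfl, h⟩ | ⟨rfl, h⟩
  · exact use (e / 2) 0 0 (by omega) (h0 _ (by omega)) (h0 _ (by omega)) (by decide)
  · exact use (e / 2) 2 2 (by omega) (h2 _ (by omega) (by omega))
      (h2 _ (by omega) (by omega)) (by decide)
  · exact use (4 * c) 1 1 (by omega) (h1 _ (by omega)) (h1 _ (by omega)) (by decide)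
  · exact use (e / 2) 5 5 (by omega) (h5 _ (by omega) (by omega))
      (h5 _ (by omega) (by omega)) (by decide)
  · exact use (4 * c) 1 0 (by omega) (h1 _ rfl) (h0 _ (by omega)) (by decide)
  · exact use (2 * c + (e - 8 * c) / 2) 2 3 (by omega) (h2 _ (by omega) (by omega))
      (h3 _ (by omega) (by omega)) (by decide)
  · exact use ((e - 2 * c) / 2) 0 2 (by omega) (h0 _ (by omega))
      (h2 _ (by omega) (by omega)) (by decide)
  · exact use (4 * c) 1 3 (by omega) (h1 _ rfl) (h3 _ (by omega) (by omega)) (by decide)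
  · exact use ((e - 6 * c) / 2) 0 3 (by omega) (h0 _ (by omega))
      (h3 _ (by omega) (by omega)) (by decide)
  · exact use ((e - 8 * c) / 2) 0 4 (by omega) (h0 _ (by omega))
      (h4 _ (by omega) (by omega)) (by decide)
  · exact use ((e - 4 * c) / 2) 0 5 (by omega) (h0 _ (by omega))
      (h5 _ (by omega) (by omega)) (by decide)
  · exact use 0 0 6 (by omega) (h0 _ (by omega)) (h6 _ (by omega)) (by decide)
  · exact use (2 * c + (e - 6 * c) / 2) 2 5 (by omega) (h2 _ (by omega) (by omega))
      (h5 _ (by omega) (by omega)) (by decide)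

theorem mod_two_xor_mod_two (a b : ℕ) : (a % 2) ^^^ (b % 2) = (a + b) % 2 := by
  rcases Nat.mod_two_eq_zero_or_one a with ha | ha <;>
  rcases Nat.mod_two_eq_zero_or_one b with hb | hb <;> simp [Nat.add_mod, ha, hb]

theorem xor_parity_xor_parity (v w a b : ℕ) :
    (v ^^^ (a % 2)) ^^^ (w ^^^ (b % 2)) = (v ^^^ w) ^^^ ((a + b) % 2) := by
  rw [← mod_two_xor_mod_two]
  ac_rfl

theorem xor_eq_iff_eq_xor {a b v : ℕ} : a ^^^ b = v ↔ v ^^^ b = a := by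
  constructor <;> rintro rfl <;> simp

theorem minExcess_xor_le {c v w : ℕ} (hc : 0 < c) (hv : v < 8) (hw : w < 8) :
    minExcess c (v ^^^ w) ≤ minExcess c v + minExcess c w := by
  interval_cases v <;> interval_cases w <;> simp [minExcess] <;> omega

theorem blockVal_lt (c x : ℕ) : blockVal c x < 8 := by
  rcases blockVal_cases c x with h | h | h | h | h | h | h <;> omega

theorem minExcess_blockVal_le (c x : ℕ) : minExcess c (blockVal c x) ≤ x := by
  rcases blockVal_cases c x with h | h | h | h | h | h | h <;> simp [h, minExcess]

theorem exists_minExcess_le {c : ℕ} (hc : 0 < c) (l : List ℕ) (hl : ∀ x ∈ l, 0 < x) :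
    ∃ w < 8, ∃ m, l.sum = m + l.length ∧ minExcess c w ≤ m ∧
      (l.map (closedG c)).foldr (· ^^^ ·) 0 = w ^^^ (m % 2) := by
  induction l with
  | nil => exact ⟨0, by simp, 0, by simp [minExcess]⟩
  | cons a l ih =>
    obtain ⟨w, hw, m, h1, h2, h3⟩ := ih fun x hx => hl x (by simp [hx])
    have ha := hl a (by simp)
    have hb := blockVal_lt c (a - 1)
    refine ⟨blockVal c (a - 1) ^^^ w, Nat.xor_lt_two_pow (n := 3) hb hw, a - 1 + m, ?_, ?_, ?_⟩
    · simp only [List.sum_cons, List.length_cons]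
      omega
    · have := minExcess_xor_le hc hb hw
      have := minExcess_blockVal_le c (a - 1)
      omega
    · simp only [List.map_cons, List.foldr_cons, h3]
      rw [closedG, xor_parity_xor_parity]

theorem exists_list_low_block {c : ℕ} (hc : 0 < c) (k : ℕ) :
    ∀ m ≤ k * (2 * c - 1), ∃ l : List ℕ, l.length = k ∧ (∀ x ∈ l, 0 < x) ∧ l.sum = m + k ∧
      (l.map (closedG c)).foldr (· ^^^ ·) 0 = m % 2 := by
  induction k with
  | zero => intro m hm; exact ⟨[], by simp_all⟩
  | succ k ih =>
    intro m hm
    obtain ⟨l, h1, h2, h3, h4⟩ := ih (m - min m (2 * c - 1)) (by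
      rw [Nat.succ_mul] at hm; omega)
    have hb : blockVal c (min m (2 * c - 1)) = 0 := by
      rw [blockVal, if_pos (by omega)]
    refine ⟨(min m (2 * c - 1) + 1) :: l, by simp [h1], ?_, ?_, ?_⟩
    · intro x hx
      rcases List.mem_cons.1 hx with rfl | hx
      · omega
      · exact h2 x hx
    · simp only [List.sum_cons, h3]
      omega
    · simp only [List.map_cons, List.foldr_cons, h4, closedG, Nat.add_sub_cancel, hb,
        Nat.zero_xor, mod_two_xor_mod_two]
      congr 1
      omega

theorem exists_list_of_minExcess_le {c m w : ℕ} (hc : 3 ≤ c) (hm : m < 10 * c) (hw : w < 6)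
    (h : minExcess c w ≤ m) :
    ∃ l : List ℕ, l.length = 2 * c + 1 ∧ (∀ x ∈ l, 0 < x) ∧ l.sum = m + (2 * c + 1) ∧
      (l.map (closedG c)).foldr (· ^^^ ·) 0 = w ^^^ (m % 2) := by
  have hb : blockVal c (minExcess c w) = w := by
    interval_cases w <;> simp only [minExcess, blockVal, ↓reduceIte, OfNat.ofNat_ne_zero, OfNat.ofNat_ne_one, one_ne_zero, Nat.reduceEqDiff] <;> split_ifs <;> omega
  have hk : 10 * c ≤ 2 * c * (2 * c - 1) := by
    obtain ⟨k, rfl⟩ := Nat.exists_eq_add_of_le hc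
    have : 2 * (3 + k) - 1 = 5 + 2 * k := by omega
    rw [this]
    nlinarith
  obtain ⟨l, h1, h2, h3, h4⟩ := exists_list_low_block (c := c) (by omega) (2 * c)
    (m - minExcess c w) (by omega)
  refine ⟨(minExcess c w + 1) :: l, by simp [h1], ?_, ?_, ?_⟩
  · intro x hx
    rcases List.mem_cons.1 hx with rfl | hx
    · omega
    · exact h2 x hx
  · simp only [List.sum_cons, h3]
    omega
  · simp only [List.map_cons, List.foldr_cons, h4, closedG, Nat.add_sub_cancel, hb]
    rw [Nat.xor_assoc, mod_two_xor_mod_two]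
    congr 2
    omega

/-- Sufficient conditions, in terms of `closedG` alone, for a value to be an option. -/
theorem closedG_options {c n u : ℕ} (hc : 3 ≤ c) (hn : 0 < n) (hn2 : n ≤ 12 * c)
    (hu : u < closedG c n) :
    (2 ≤ n ∧ PairVal c (n - 2) (u ^^^ (n % 2))) ∨
      (2 * c + 1 ≤ n ∧ u ^^^ ((n - 1) % 2) < 6 ∧
        minExcess c (u ^^^ ((n - 1) % 2)) ≤ n - 1 - 2 * c) := by
  unfold closedG at hu
  rcases Nat.mod_two_eq_zero_or_one n with hp | hp
  · have hp' : (n - 1) % 2 = 1 := by omega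
    rw [hp'] at hu ⊢
    rw [hp]
    rcases blockVal_cases c (n - 1) with h | h | h | h | h | h | h <;>
      simp only [h, Nat.reduceXor] at hu <;> interval_cases u <;>
      simp [PairVal, minExcess] <;> omega
  · have hp' : (n - 1) % 2 = 0 := by omega
    rw [hp'] at hu ⊢
    rw [hp]
    rcases blockVal_cases c (n - 1) with h | h | h | h | h | h | h <;>
      simp only [h, Nat.reduceXor] at hu <;> interval_cases u <;>
      simp [PairVal, minExcess] <;> omega

theorem not_pairVal_closedG {c n : ℕ} (hn : 2 ≤ n) (hn2 : n ≤ 12 * c) :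
    ¬ PairVal c (n - 2) (closedG c n ^^^ (n % 2)) := by
  have : closedG c n ^^^ (n % 2) = blockVal c (n - 1) ^^^ 1 := by
    rw [closedG, Nat.xor_assoc, mod_two_xor_mod_two]
    congr 1
    omega
  rw [this]
  rcases blockVal_cases c (n - 1) with h | h | h | h | h | h | h <;>
    simp [h, PairVal] <;> omega

theorem lt_minExcess_blockVal {c n : ℕ} (hn : 2 * c + 1 ≤ n) (hn2 : n ≤ 12 * c) :
    n - 1 - 2 * c < minExcess c (blockVal c (n - 1)) := by
  rcases blockVal_cases c (n - 1) with h | h | h | h | h | h | h <;>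
    simp [h, minExcess] <;> omega

theorem cutG_eq_closedG {c : ℕ} (hc : 3 ≤ c) (n : ℕ) (hn : 0 < n) (hn2 : n ≤ 12 * c) :
    cutG {1, 2 * c} n = closedG c n := by
  induction n using Nat.strong_induction_on with
  | _ n ih =>
    have hC : 0 ∉ ({1, 2 * c} : Finset ℕ) := by
      simp only [Finset.mem_insert, Finset.mem_singleton]
      omega
    have hval : ∀ l : List ℕ, 2 ≤ l.length → (∀ x ∈ l, 0 < x) → l.sum = n →
        nimVal {1, 2 * c} l = (l.map (closedG c)).foldr (· ^^^ ·) 0 := by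
      intro l hl hpos hsum
      rw [nimVal]
      congr 1
      refine List.map_congr_left fun x hx => ?_
      have := List.lt_sum_of_mem_of_forall_pos hpos hl hx
      exact ih x (by omega) (hpos x hx) (by omega)
    rw [cutG_eq_mex hC hn]
    refine mex_eq ?_ fun u hu => ?_
    · rintro ⟨d, hd, l, h1, h2, h3, h4⟩
      simp only [Finset.mem_insert, Finset.mem_singleton] at hd
      rw [hval l (by omega) h2 h3] at h4
      rcases hd with rfl | rfl
      · obtain ⟨x, y, rfl⟩ := List.length_eq_two.1 h1
        have hx := h2 x (by simp)
        have hy := h2 y (by simp)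
        simp only [List.sum_cons, List.sum_nil] at h3
        apply not_pairVal_closedG (n := n) (by omega) hn2
        have := pairVal_of_add (c := c) (x := x - 1) (y := y - 1) (by omega)
        rw [← h4]
        simp only [List.map_cons, List.map_nil, List.foldr_cons, List.foldr_nil, Nat.xor_zero]
        rw [closedG, closedG, xor_parity_xor_parity, Nat.xor_assoc, mod_two_xor_mod_two]
        rwa [show (x - 1 + (y - 1) + n) % 2 = 0 by omega, Nat.xor_zero,
          show n - 2 = x - 1 + (y - 1) by omega]
      · obtain ⟨w, hw, m, h5, h6, h7⟩ := exists_minExcess_le (by omega : 0 < c) l h2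
        have := lt_minExcess_blockVal (n := n) (by omega) hn2
        rw [h7, closedG, show (n - 1) % 2 = m % 2 by omega] at h4
        rw [← Nat.xor_left_inj.1 h4] at this
        omega
    · rcases closedG_options hc hn hn2 hu with ⟨h1, h2⟩ | ⟨h1, h2, h3⟩
      · obtain ⟨x, y, h4, h5⟩ := exists_add_of_pairVal hc (by omega) h2
        refine ⟨1, by simp, [x + 1, y + 1], by simp, by simp, by simp; omega, ?_⟩
        rw [hval _ (by simp) (by simp) (by simp; omega)]
        simp only [List.map_cons, List.map_nil, List.foldr_cons, List.foldr_nil, Nat.xor_zero]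
        rw [closedG, closedG, xor_parity_xor_parity]
        simp only [Nat.add_sub_cancel]
        rw [h5, h4, Nat.xor_assoc, mod_two_xor_mod_two, show (n + (n - 2)) % 2 = 0 by omega,
          Nat.xor_zero]
      · obtain ⟨l, h4, h5, h6, h7⟩ := exists_list_of_minExcess_le hc (by omega) h2 h3
        refine ⟨2 * c, by simp, l, h4, h5, by omega, ?_⟩
        rw [hval l (by omega) h5 (by omega), h7, Nat.xor_assoc, mod_two_xor_mod_two,
          show ((n - 1) + (n - 1 - 2 * c)) % 2 = 0 by omega, Nat.xor_zero]

theorem mem_nimSet_two_iff {c n v : ℕ} (hc : 3 ≤ c) (hn2 : n ≤ 12 * c) :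
    v ∈ nimSet n 2 {1, 2 * c} ↔ 2 ≤ n ∧ PairVal c (n - 2) (v ^^^ (n % 2)) := by
  have hval : ∀ x y, x + y + 2 = n → nimVal {1, 2 * c} [x + 1, y + 1] =
      (blockVal c x ^^^ blockVal c y) ^^^ (n % 2) := by
    intro x y h
    rw [nimVal]
    simp only [List.map_cons, List.map_nil, List.foldr_cons, List.foldr_nil, Nat.xor_zero]
    rw [cutG_eq_closedG hc _ (by omega) (by omega), cutG_eq_closedG hc _ (by omega) (by omega),
      closedG, closedG, xor_parity_xor_parity]
    simp only [Nat.add_sub_cancel]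
    rw [show (x + y) % 2 = n % 2 by omega]
  constructor
  · rintro ⟨l, h1, h2, h3, h4⟩
    obtain ⟨x, y, rfl⟩ := List.length_eq_two.1 h1
    have hx := h2 x (by simp)
    have hy := h2 y (by simp)
    obtain ⟨x, rfl⟩ : ∃ k, x = k + 1 := ⟨x - 1, by omega⟩
    obtain ⟨y, rfl⟩ : ∃ k, y = k + 1 := ⟨y - 1, by omega⟩
    simp only [List.sum_cons, List.sum_nil] at h3
    rw [hval x y (by omega), xor_eq_iff_eq_xor] at h4
    rw [h4, show n - 2 = x + y by omega]
    exact ⟨by omega, pairVal_of_add (by omega)⟩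
  · rintro ⟨h1, h2⟩
    obtain ⟨x, y, h3, h4⟩ := exists_add_of_pairVal hc (by omega) h2
    exact ⟨[x + 1, y + 1], by simp, by simp, by simp; omega, by
      rw [hval x y (by omega), xor_eq_iff_eq_xor, h4]⟩

theorem phi_one_spec {c n : ℕ} (hc : 3 ≤ c) (hn : 1 ≤ n) (hn2 : n ≤ 12 * c) :
    ∃ q < 6, ∃ r r', n = 2 * c * q + r ∧ phi c 1 n = 6 * q + r' ∧ r' % 2 = r % 2 ∧
      ((r = 1 ∧ r' = 1) ∨ (r = 2 ∧ r' = 2) ∨ (r = 2 * c - 1 ∧ r' = 5) ∨ (r = 2 * c ∧ r' = 6) ∨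
        (3 ≤ r ∧ r ≤ 2 * c - 2 ∧ 3 ≤ r' ∧ r' ≤ 4)) := by
  have hr := Nat.mod_lt (n - 1) (show 0 < 2 * c by omega)
  have hd := Nat.div_add_mod (n - 1) (2 * c)
  refine ⟨(n - 1) / (2 * c), ?_, (n - 1) % (2 * c) + 1,
    rPrime c ((n - 1) % (2 * c) + 1), by omega, ?_, ?_⟩
  · rw [Nat.div_lt_iff_lt_mul (by omega)]
    omega
  · rw [phi]
    omega
  · unfold rPrime
    split_ifs <;> omega

set_option maxHeartbeats 2000000 in
theorem pairVal_phi_iff {c n w : ℕ} (hc : 3 ≤ c) (hn : 1 ≤ n) (hn2 : n ≤ 12 * c) :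
    (2 ≤ n ∧ PairVal c (n - 2) w) ↔ (2 ≤ phi c 1 n ∧ PairVal 3 (phi c 1 n - 2) w) ∨
      (w = 0 ∧ ∃ a : ℕ, Odd a ∧ 5 ≤ a ∧ a ≤ 2 * c - 3 ∧ n = 8 * c + a) := by
  have hex : (∃ a : ℕ, Odd a ∧ 5 ≤ a ∧ a ≤ 2 * c - 3 ∧ n = 8 * c + a) ↔
      n % 2 = 1 ∧ 8 * c + 5 ≤ n ∧ n ≤ 10 * c - 3 := by
    constructor
    · rintro ⟨a, ⟨k, rfl⟩, h⟩
      omega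
    · intro h
      exact ⟨n - 8 * c, ⟨(n - 8 * c) / 2, by omega⟩, by omega, by omega, by omega⟩
  rw [hex]
  obtain ⟨q, hq, r, r', h1, h2, h3, h4⟩ := phi_one_spec hc hn hn2
  rw [h2]
  unfold PairVal
  rcases lt_or_ge w 8 with hw | hw
  · rcases h4 with h4 | h4 | h4 | h4 | h4 <;> interval_cases w <;>
    simp only [Nat.reduceEqDiff, OfNat.ofNat_ne_zero, OfNat.ofNat_ne_one, OfNat.zero_ne_ofNat,
      OfNat.one_ne_ofNat, zero_ne_one, one_ne_zero, true_and, false_and, or_false, false_or] <;>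
    interval_cases q <;> omega
  · constructor <;> intro <;> omega

theorem phi_one_le {c n : ℕ} (hc : 3 ≤ c) (hn : 1 ≤ n) (hn2 : n ≤ 12 * c) :
    phi c 1 n ≤ 36 ∧ phi c 1 n % 2 = n % 2 := by
  obtain ⟨q, hq, r, r', h1, h2, h3, h4⟩ := phi_one_spec hc hn hn2
  have : 2 * c * q = 2 * (c * q) := by ring
  omega

theorem mem_nimSet_phi_two_cut_iff {c n v : ℕ} (hc : 3 ≤ c) (hn : 1 ≤ n) (hn2 : n ≤ 12 * c) :
    v ∈ nimSet n 2 {1, 2 * c} ↔ v ∈ nimSet (phi c 1 n) 2 {1, 6} ∨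
      (v = 1 ∧ ∃ a : ℕ, Odd a ∧ 5 ≤ a ∧ a ≤ 2 * c - 3 ∧ n = 8 * c + a) := by
  obtain ⟨hp, hp2⟩ := phi_one_le hc hn hn2
  have h6 := mem_nimSet_two_iff (c := 3) (n := phi c 1 n) (v := v) le_rfl hp
  rw [mem_nimSet_two_iff hc hn2, pairVal_phi_iff hc hn hn2]
  rw [show 2 * 3 = 6 from rfl, hp2] at h6
  rw [h6]
  refine or_congr_right (and_congr_left ?_)
  rintro ⟨a, ⟨k, rfl⟩, -, -, rfl⟩
  rw [show (8 * c + (2 * k + 1)) % 2 = 1 by omega, xor_eq_iff_eq_xor]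
  simp [eq_comm]

/-- For `c ≥ 3` and `1 ≤ n ≤ 12c`: if `n = 8c + a` for some odd `a` with
`5 ≤ a ≤ 2c − 3`, then `N(n, 2, {1, 2c}) = N(φ₁(n), 2, {1, 6}) ∪ {1}`; otherwise
`N(n, 2, {1, 2c}) = N(φ₁(n), 2, {1, 6})`. -/
theorem nimSet_phi_two_cut (c : ℕ) (hc : 3 ≤ c) (n : ℕ) (hn1 : 1 ≤ n)
    (hn2 : n ≤ 12*c) :
    ((∃ a : ℕ, Odd a ∧ 5 ≤ a ∧ a ≤ 2*c - 3 ∧ n = 8*c + a) →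
      nimSet n 2 {1, 2*c} = nimSet (phi c 1 n) 2 {1, 6} ∪ {1}) ∧
    (¬ (∃ a : ℕ, Odd a ∧ 5 ≤ a ∧ a ≤ 2*c - 3 ∧ n = 8*c + a) →
      nimSet n 2 {1, 2*c} = nimSet (phi c 1 n) 2 {1, 6}) := by
  refine ⟨fun h => Set.ext fun v => ?_, fun h => Set.ext fun v => ?_⟩
  · rw [mem_nimSet_phi_two_cut_iff hc hn1 hn2, Set.mem_union, Set.mem_singleton_iff]
    simp only [h, and_true]
  · rw [mem_nimSet_phi_two_cut_iff hc hn1 hn2]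
    simp only [h, and_false, or_false]
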